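/- Let S be a commutative ring, I an ideal of S, and hI : DividedPowers I a divided power structure. For every prime p and every e ≥ 1 there exists a natural number c with c ≡ 1 (mod p) such that for every a ∈ I, the e-fold iterate of hI.dpow p satisfies (hI.dpow p)^[e] a = c • hI.dpow (p^e) a. -/

import Mathlib

/-- The number of partitions of a set with `m * p` elements into `m` blocks of prime size `p`
is congruent to `1` modulo `p`. -/
theorem Nat.Prime.uniformBell_modEq_one {p : ℕ} (hp : p.Prime) (m : ℕ) :
    Nat.uniformBell m p ≡ 1 [MOD p] := by
  have : Fact p.Prime := ⟨hp⟩
  have hlt : p - 1 < p := Nat.sub_lt hp.pos one_pos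
  induction m with
  | zero => rw [Nat.uniformBell_zero_left]
  | succ m ih =>
    have hchoose : (m * p + p - 1).choose (p - 1) ≡ 1 [MOD p] := by
      have h := Choose.choose_modEq_choose_mod_mul_choose_div_nat
        (n := m * p + p - 1) (k := p - 1) (p := p)
      have hmod : (m * p + p - 1) % p = p - 1 := by
        rw [Nat.add_sub_assoc hp.one_le, Nat.mul_add_mod', Nat.mod_eq_of_lt hlt]
      rwa [hmod, Nat.mod_eq_of_lt hlt, Nat.div_eq_of_lt hlt, Nat.choose_self,
        Nat.choose_zero_right] at h
    rw [Nat.uniformBell_succ_left]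
    exact hchoose.mul ih

/-- For any divided power structure, any prime `p` and any `e ≥ 1`, there is
a natural number `c ≡ 1 (mod p)` with `(dpow p)^[e] a = c • dpow (p^e) a` for all `a ∈ I`. -/
theorem iterate_dpow_prime_eq_smul {S : Type*} [CommRing S] {I : Ideal S}
    (hI : DividedPowers I) (p : ℕ) (hp : p.Prime) (e : ℕ) (he : 1 ≤ e) :
    ∃ c : ℕ, c ≡ 1 [MOD p] ∧ ∀ a ∈ I, (hI.dpow p)^[e] a = c • hI.dpow (p ^ e) a := by
  clear he
  induction e with
  | zero => exact ⟨1, rfl, fun a ha => by simp [hI.dpow_one ha]⟩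
  | succ e ih =>
    obtain ⟨c, hc, h⟩ := ih
    refine ⟨c * Nat.uniformBell (p ^ e) p, hc.mul (hp.uniformBell_modEq_one _), fun a ha => ?_⟩
    rw [Function.iterate_succ_apply, h _ (hI.dpow_mem hp.ne_zero ha),
      hI.dpow_comp hp.ne_zero ha, ← nsmul_eq_mul, smul_smul, pow_succ]
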